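/- arXiv:1909.08885 — 4 statements merged into one kernel-verified Lean document; each statement's English description precedes it below -/
import Mathlib

section
/- Let n ≥ 1, A ≥ 0, B ≥ -(n-2)²/4, ρ = ((2-n)+√((n-2)²+4B))/2, α = (n+A−1+2ρ)/2, γ = n−1+2ρ, and let β ∈ ℝ, λ ≥ 0. Let φ : (0,1) → ℝ be twice continuously differentiable and define Φ(t,r) = (t+r+λ)^{−β} φ(2r/(t+r+λ)). Then for every (t,r) with 0 < r < t + λ, writing z = 2r/(t+r+λ), one has the identity ∂_t²Φ − (A/r)∂_tΦ − ∂_r²Φ − ((n−1+2ρ)/r)∂_rΦ = −4 z^{−1}(t+r+λ)^{−β−2} [ z(1−z)φ''(z) + (γ − (α+β+1)z)φ'(z) − αβ φ(z) ]. In particular Φ solves ∂_t²Φ − (A/r)∂_tΦ − ∂_r²Φ − ((n−1+2ρ)/r)∂_rΦ = 0 on {0 < r < t+λ} if and only if φ solves the hypergeometric equation z(1−z)φ'' + (γ − (α+β+1)z)φ' − αβφ = 0 on (0,1). -/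
/-- The radial wave operator `∂_t² − (A/r)∂_t − ∂_r² − (c/r)∂_r` applied to a
function `u = u(t,r)`. -/
noncomputable def radialOp (A c : ℝ) (u : ℝ → ℝ → ℝ) (t r : ℝ) : ℝ :=
  deriv (fun t' => deriv (fun t'' => u t'' r) t') t
    - A / r * deriv (fun t' => u t' r) t
    - deriv (fun r' => deriv (fun r'' => u t r'') r') r
    - c / r * deriv (fun r' => u t r') r

theorem hasDerivAt_homogeneous_time {f : ℝ → ℝ} {d p t r lam : ℝ} (hs : 0 < t + r + lam)
    (hf : HasDerivAt f d (2 * r / (t + r + lam))) :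
    HasDerivAt (fun t' => (t' + r + lam) ^ p * f (2 * r / (t' + r + lam)))
      ((t + r + lam) ^ (p - 1) *
        (p * f (2 * r / (t + r + lam)) - 2 * r / (t + r + lam) * d)) t := by
  have h1 : HasDerivAt (fun t' : ℝ => t' + r + lam) 1 t :=
    ((hasDerivAt_id t).add_const r).add_const lam
  have h2 := (hasDerivAt_const t (2 * r)).fun_div h1 hs.ne'
  have h3 := (h1.rpow_const (p := p) (Or.inl hs.ne')).fun_mul (hf.comp t h2)
  refine h3.congr_deriv ?_
  have h4 : (t + r + lam) ^ p = (t + r + lam) ^ (p - 1) * (t + r + lam) := by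
    rw [Real.rpow_sub_one hs.ne', div_mul_cancel₀ _ hs.ne']
  simp only [Function.comp_apply]
  rw [h4]
  field_simp
  ring

theorem hasDerivAt_homogeneous_radius {f : ℝ → ℝ} {d p t r lam : ℝ} (hs : 0 < t + r + lam)
    (hf : HasDerivAt f d (2 * r / (t + r + lam))) :
    HasDerivAt (fun r' => (t + r' + lam) ^ p * f (2 * r' / (t + r' + lam)))
      ((t + r + lam) ^ (p - 1) *
        (p * f (2 * r / (t + r + lam)) + (2 - 2 * r / (t + r + lam)) * d)) r := by
  have h1 : HasDerivAt (fun r' : ℝ => t + r' + lam) 1 r :=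
    ((hasDerivAt_id r).const_add t).add_const lam
  have h0 : HasDerivAt (fun r' : ℝ => 2 * r') 2 r := by
    simpa using (hasDerivAt_id r).const_mul (2 : ℝ)
  have h2 := h0.fun_div h1 hs.ne'
  have h3 := (h1.rpow_const (p := p) (Or.inl hs.ne')).fun_mul (hf.comp r h2)
  refine h3.congr_deriv ?_
  have h4 : (t + r + lam) ^ p = (t + r + lam) ^ (p - 1) * (t + r + lam) := by
    rw [Real.rpow_sub_one hs.ne', div_mul_cancel₀ _ hs.ne']
  simp only [Function.comp_apply]
  rw [h4]
  field_simp

theorem selfSimilar_mem_Ioo {t r lam : ℝ} (hr : 0 < r) (hrt : r < t + lam) :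
    2 * r / (t + r + lam) ∈ Set.Ioo (0 : ℝ) 1 :=
  ⟨div_pos (by linarith) (by linarith), (div_lt_one (by linarith)).2 (by linarith)⟩

theorem radialOp_selfSimilar (A c β lam : ℝ) {φ : ℝ → ℝ}
    (hφ : ContDiffOn ℝ 2 φ (Set.Ioo 0 1)) {t r : ℝ} (hr : 0 < r) (hrt : r < t + lam) :
    radialOp A c (fun t r => (t + r + lam) ^ (-β) * φ (2 * r / (t + r + lam))) t r
      = -4 * (2 * r / (t + r + lam))⁻¹ * (t + r + lam) ^ (-β - 2) *
          ((2 * r / (t + r + lam)) * (1 - 2 * r / (t + r + lam)) *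
              deriv (deriv φ) (2 * r / (t + r + lam))
            + (c - ((c + A) / 2 + β + 1) * (2 * r / (t + r + lam))) *
              deriv φ (2 * r / (t + r + lam))
            - (c + A) / 2 * β * φ (2 * r / (t + r + lam))) := by
  have hs : 0 < t + r + lam := by linarith
  have hz := selfSimilar_mem_Ioo hr hrt
  have hd1 : ∀ z ∈ Set.Ioo (0 : ℝ) 1, HasDerivAt φ (deriv φ z) z := fun z hz =>
    ((hφ.differentiableOn (by norm_num)).differentiableAt (isOpen_Ioo.mem_nhds hz)).hasDerivAt
  have hd2 : ∀ z ∈ Set.Ioo (0 : ℝ) 1, HasDerivAt (deriv φ) (deriv (deriv φ) z) z := fun z hz =>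
    (((hφ.deriv_of_isOpen (m := 1) isOpen_Ioo (by norm_num)).differentiableOn
      (by norm_num)).differentiableAt (isOpen_Ioo.mem_nhds hz)).hasDerivAt
  have hT : (fun t' => deriv (fun t'' => (t'' + r + lam) ^ (-β) * φ (2 * r / (t'' + r + lam))) t')
      =ᶠ[nhds t] fun t' => (t' + r + lam) ^ (-β - 1) *
        (fun z => -β * φ z - z * deriv φ z) (2 * r / (t' + r + lam)) := by
    filter_upwards [lt_mem_nhds (show r - lam < t by linarith)] with t' ht'
    have hrt' : r < t' + lam := by linarith
    exact (hasDerivAt_homogeneous_time (by linarith) (hd1 _ (selfSimilar_mem_Ioo hr hrt'))).deriv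
  have hR : (fun r' => deriv (fun r'' => (t + r'' + lam) ^ (-β) * φ (2 * r'' / (t + r'' + lam))) r')
      =ᶠ[nhds r] fun r' => (t + r' + lam) ^ (-β - 1) *
        (fun z => -β * φ z + (2 - z) * deriv φ z) (2 * r' / (t + r' + lam)) := by
    filter_upwards [Ioo_mem_nhds hr hrt] with r' hr'
    exact (hasDerivAt_homogeneous_radius (by linarith [hr'.1])
      (hd1 _ (selfSimilar_mem_Ioo hr'.1 hr'.2))).deriv
  have hTT := (hasDerivAt_homogeneous_time (p := -β - 1) hs
    (((hd1 _ hz).const_mul (-β)).fun_sub ((hasDerivAt_id' _).fun_mul (hd2 _ hz)))).deriv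
  have hRR := (hasDerivAt_homogeneous_radius (p := -β - 1) hs
    (((hd1 _ hz).const_mul (-β)).fun_add
      (((hasDerivAt_id' _).const_sub 2).fun_mul (hd2 _ hz)))).deriv
  unfold radialOp
  rw [hT.deriv_eq, hR.deriv_eq, hTT, hRR,
    (hasDerivAt_homogeneous_time hs (hd1 _ hz)).deriv,
    (hasDerivAt_homogeneous_radius hs (hd1 _ hz)).deriv]
  have h4 : (t + r + lam) ^ (-β - 1) = (t + r + lam) ^ (-β - 2) * (t + r + lam) := by
    rw [← Real.rpow_add_one hs.ne']
    congr 1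
    ring
  rw [show -β - 1 - 1 = -β - 2 by ring, h4]
  generalize (t + r + lam) ^ (-β - 2) = P
  generalize deriv (deriv φ) _ = c2
  generalize deriv φ _ = c1
  generalize φ _ = c0
  field_simp
  ring

/-- for `Φ(t,r) = (t+r+λ)^{−β} φ(2r/(t+r+λ))`, on the region
`0 < r < t + λ`, with `z = 2r/(t+r+λ)`,
`∂_t²Φ − (A/r)∂_tΦ − ∂_r²Φ − ((n−1+2ρ)/r)∂_rΦ
  = −4 z⁻¹ (t+r+λ)^{−β−2} [z(1−z)φ'' + (γ−(α+β+1)z)φ' − αβφ]`;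
in particular `Φ` solves the transformed equation on `{0 < r < t+λ}` iff `φ`
satisfies the hypergeometric ODE on `(0,1)`. -/
theorem stmt1 (n : ℕ) (hn : 1 ≤ n) (A B : ℝ) (hA : 0 ≤ A)
    (hB : -((n : ℝ) - 2) ^ 2 / 4 ≤ B)
    (ρ : ℝ) (hρ : ρ = ((2 - (n : ℝ)) + Real.sqrt (((n : ℝ) - 2) ^ 2 + 4 * B)) / 2)
    (α γ : ℝ) (hα : α = ((n : ℝ) + A - 1 + 2 * ρ) / 2) (hγ : γ = (n : ℝ) - 1 + 2 * ρ)
    (β lam : ℝ) (hlam : 0 ≤ lam)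
    (φ : ℝ → ℝ) (hφ : ContDiffOn ℝ 2 φ (Set.Ioo 0 1))
    (Φ : ℝ → ℝ → ℝ)
    (hΦ : ∀ t r : ℝ, Φ t r = (t + r + lam) ^ (-β) * φ (2 * r / (t + r + lam))) :
    (∀ t r : ℝ, 0 < r → r < t + lam →
      radialOp A ((n : ℝ) - 1 + 2 * ρ) Φ t r
        = -4 * (2 * r / (t + r + lam))⁻¹ * (t + r + lam) ^ (-β - 2) *
          ((2 * r / (t + r + lam)) * (1 - 2 * r / (t + r + lam)) *
              deriv (deriv φ) (2 * r / (t + r + lam))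
            + (γ - (α + β + 1) * (2 * r / (t + r + lam))) *
              deriv φ (2 * r / (t + r + lam))
            - α * β * φ (2 * r / (t + r + lam)))) ∧
    ((∀ t r : ℝ, 0 < r → r < t + lam → radialOp A ((n : ℝ) - 1 + 2 * ρ) Φ t r = 0) ↔
      (∀ z ∈ Set.Ioo (0 : ℝ) 1,
        z * (1 - z) * deriv (deriv φ) z + (γ - (α + β + 1) * z) * deriv φ z
          - α * β * φ z = 0)) := by
  obtain rfl : Φ = fun t r => (t + r + lam) ^ (-β) * φ (2 * r / (t + r + lam)) :=
    funext₂ hΦ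
  have hα' : α = ((n : ℝ) - 1 + 2 * ρ + A) / 2 := by rw [hα]; ring
  subst hα' hγ
  refine ⟨fun t r hr hrt => radialOp_selfSimilar A _ β lam hφ hr hrt, fun h z hz => ?_,
    fun h t r hr hrt => ?_⟩
  · have hr : 0 < z / 2 := half_pos hz.1
    have hrt : z / 2 < 1 - z / 2 - lam + lam := by linarith [hz.2]
    have h1 := h _ _ hr hrt
    rw [radialOp_selfSimilar A _ β lam hφ hr hrt,
      show 1 - z / 2 - lam + z / 2 + lam = 1 by ring,
      show 2 * (z / 2) / 1 = z by ring, Real.one_rpow] at h1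
    exact (mul_eq_zero.1 h1).resolve_left (by simp [hz.1.ne'])
  · rw [radialOp_selfSimilar A _ β lam hφ hr hrt, h _ (selfSimilar_mem_Ioo hr hrt), mul_zero]
end

section
/- Let α, β, γ be real numbers with γ > α > 0, and define for z ∈ (0,1) the function F(α,β,γ;z) = (Γ(γ)/(Γ(α)Γ(γ−α))) ∫₀¹ s^{α−1}(1−s)^{γ−α−1}(1−zs)^{−β} ds. Then F(α,β,γ;·) is twice differentiable on (0,1) and satisfies the hypergeometric equation z(1−z)F''(z) + (γ − (α+β+1)z)F'(z) − αβ F(z) = 0 for all z ∈ (0,1). -/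
open MeasureTheory

/-- The hypergeometric function via the Euler integral representation,
`F(α,β,γ;z) = (Γ(γ)/(Γ(α)Γ(γ−α))) ∫₀¹ s^{α−1}(1−s)^{γ−α−1}(1−zs)^{−β} ds`,
valid for `γ > α > 0` and `z < 1`. -/
noncomputable def hyperF (α β γ z : ℝ) : ℝ :=
  (Real.Gamma γ / (Real.Gamma α * Real.Gamma (γ - α))) *
    ∫ s in (0 : ℝ)..1, s ^ (α - 1) * (1 - s) ^ (γ - α - 1) * (1 - z * s) ^ (-β)

/-- The unnormalized Euler integral `∫₀¹ s^{a−1}(1−s)^{b−1}(1−zs)^{−β} ds`. -/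
noncomputable def eulerIntegral (a b β z : ℝ) : ℝ :=
  ∫ s in (0 : ℝ)..1, s ^ (a - 1) * (1 - s) ^ (b - 1) * (1 - z * s) ^ (-β)

lemma one_sub_mul_pos_of_mem_Icc {z s : ℝ} (hz : z < 1) (hs : s ∈ Set.Icc (0 : ℝ) 1) :
    0 < 1 - z * s := by
  obtain ⟨h0, h1⟩ := hs
  rcases le_or_gt z 0 with h | h <;> nlinarith

lemma intervalIntegrable_rpow_mul_one_sub_rpow {a b : ℝ} (ha : 0 < a) (hb : 0 < b) :
    IntervalIntegrable (fun s : ℝ => s ^ (a - 1) * (1 - s) ^ (b - 1)) volume 0 1 := by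
  have left (u v : ℝ) (hu : 0 < u) :
      IntervalIntegrable (fun s : ℝ => s ^ (u - 1) * (1 - s) ^ (v - 1)) volume 0 (1 / 2) := by
    refine (intervalIntegral.intervalIntegrable_rpow' (by linarith)).mul_continuousOn ?_
    refine ContinuousOn.rpow_const (by fun_prop) fun s hs => Or.inl ?_
    rw [Set.uIcc_of_le (by norm_num)] at hs
    linarith [hs.2]
  refine (left a b ha).trans ?_
  have h := ((left b a hb).comp_sub_left 1).symm
  norm_num at h ⊢
  simpa only [mul_comm] using h

lemma continuousOn_one_sub_mul_rpow {z : ℝ} (hz : z < 1) (p : ℝ) :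
    ContinuousOn (fun s : ℝ => (1 - z * s) ^ p) (Set.Icc 0 1) :=
  ContinuousOn.rpow_const (by fun_prop) fun _ hs =>
    Or.inl (one_sub_mul_pos_of_mem_Icc hz hs).ne'

lemma intervalIntegrable_eulerIntegrand {a b z : ℝ} (ha : 0 < a) (hb : 0 < b) (β : ℝ)
    (hz : z < 1) :
    IntervalIntegrable (fun s : ℝ => s ^ (a - 1) * (1 - s) ^ (b - 1) * (1 - z * s) ^ (-β))
      volume 0 1 := by
  refine (intervalIntegrable_rpow_mul_one_sub_rpow ha hb).mul_continuousOn ?_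
  rw [Set.uIcc_of_le zero_le_one]
  exact continuousOn_one_sub_mul_rpow hz _

lemma hasDerivAt_eulerIntegral {a b z : ℝ} (ha : 0 < a) (hb : 0 < b) (β : ℝ) (hz : z < 1) :
    HasDerivAt (eulerIntegral a b β) (β * eulerIntegral (a + 1) b (β + 1) z) z := by
  have hlt {x : ℝ} (hx : x ∈ Metric.closedBall z ((1 - z) / 2)) : x < 1 := by
    rw [Real.closedBall_eq_Icc] at hx
    linarith [hx.2]
  obtain ⟨C, hC⟩ := ((isCompact_closedBall z ((1 - z) / 2)).prod
    (isCompact_Icc (a := (0 : ℝ)) (b := 1))).exists_bound_of_continuousOn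
      (f := fun q : ℝ × ℝ => (1 - q.1 * q.2) ^ (-(β + 1)))
      (ContinuousOn.rpow_const (by fun_prop) fun q hq =>
        Or.inl (one_sub_mul_pos_of_mem_Icc (hlt hq.1) hq.2).ne')
  have hmem : Metric.closedBall z ((1 - z) / 2) ∈ nhds z :=
    Metric.closedBall_mem_nhds z (by linarith)
  have key := (intervalIntegral.hasDerivAt_integral_of_dominated_loc_of_deriv_le
    (a := 0) (b := 1) (μ := volume) (x₀ := z)
    (F := fun x s : ℝ => s ^ (a - 1) * (1 - s) ^ (b - 1) * (1 - x * s) ^ (-β))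
    (F' := fun x s : ℝ =>
      β * (s ^ (a + 1 - 1) * (1 - s) ^ (b - 1) * (1 - x * s) ^ (-(β + 1))))
    (bound := fun s : ℝ => |β| * (|s ^ (a + 1 - 1) * (1 - s) ^ (b - 1)| * C)) hmem
    (Filter.Eventually.of_forall fun x => by fun_prop)
    (intervalIntegrable_eulerIntegrand ha hb β hz) (by fun_prop)
    (Filter.Eventually.of_forall fun s hs x hx => ?_)
    (((intervalIntegrable_rpow_mul_one_sub_rpow (by linarith) hb).abs.mul_const C).const_mul _)
    (Filter.Eventually.of_forall fun s hs x hx => ?_)).2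
  · rwa [intervalIntegral.integral_const_mul] at key
  · rw [Set.uIoc_of_le zero_le_one] at hs
    rw [norm_mul, norm_mul]
    have := hC (x, s) ⟨hx, hs.1.le, hs.2⟩
    simp only [Real.norm_eq_abs] at this ⊢
    gcongr
  · rw [Set.uIoc_of_le zero_le_one] at hs
    have hpos := one_sub_mul_pos_of_mem_Icc (hlt hx) ⟨hs.1.le, hs.2⟩
    have h1 : HasDerivAt (fun x : ℝ => 1 - x * s) (-s) x := by
      simpa using ((hasDerivAt_id x).mul_const s).const_sub 1
    convert! (h1.rpow_const (p := -β) (Or.inl hpos.ne')).const_mul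
      (s ^ (a - 1) * (1 - s) ^ (b - 1)) using 1
    rw [show a + 1 - 1 = a - 1 + 1 by ring, Real.rpow_add_one hs.1.ne',
      show -(β + 1) = -β - 1 by ring]
    ring

/-- The hypergeometric equation for the Euler integral: the integrand of the left-hand side is
the derivative of `-β s^a (1−s)^b (1−zs)^{−β−1}`, which vanishes at both endpoints. -/
lemma eulerIntegral_hypergeometric_equation {a b z : ℝ} (ha : 0 < a) (hb : 0 < b) (β : ℝ)
    (hz : z < 1) :
    z * (1 - z) * (β * ((β + 1) * eulerIntegral (a + 1 + 1) b (β + 1 + 1) z))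
      + (a + b - (a + β + 1) * z) * (β * eulerIntegral (a + 1) b (β + 1) z)
      - a * β * eulerIntegral a b β z = 0 := by
  have i0 := intervalIntegrable_eulerIntegrand ha hb β hz
  have i1 := intervalIntegrable_eulerIntegrand (a := a + 1) (by linarith) hb (β + 1) hz
  have i2 := intervalIntegrable_eulerIntegrand (a := a + 1 + 1) (by linarith) hb (β + 1 + 1) hz
  have j2 := i2.const_mul (z * (1 - z) * (β * (β + 1)))
  have j1 := i1.const_mul ((a + b - (a + β + 1) * z) * β)
  have j0 := i0.const_mul (a * β)
  have ftc := intervalIntegral.integral_eq_sub_of_hasDerivAt_of_le zero_le_one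
    (f := fun s : ℝ => -β * (s ^ a * (1 - s) ^ b * (1 - z * s) ^ (-β - 1)))
    (continuousOn_const.mul
      (((Real.continuous_rpow_const ha.le).continuousOn.mul
        (ContinuousOn.rpow_const (by fun_prop) fun _ _ => Or.inr hb.le)).mul
        (continuousOn_one_sub_mul_rpow hz _)))
    (fun s hs => ?_) ((j2.add j1).sub j0)
  · rw [intervalIntegral.integral_sub (j2.add j1) j0, intervalIntegral.integral_add j2 j1] at ftc
    simp only [intervalIntegral.integral_const_mul, Real.zero_rpow ha.ne', sub_self,
      Real.zero_rpow hb.ne', zero_mul, mul_zero] at ftc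
    simp only [eulerIntegral]
    linear_combination ftc
  · have hs1 : 0 < 1 - s := by linarith [hs.2]
    have hpos := one_sub_mul_pos_of_mem_Icc hz (Set.Ioo_subset_Icc_self hs)
    have d1 : HasDerivAt (fun s : ℝ => 1 - s) (-1) s := (hasDerivAt_id s).const_sub 1
    have d2 : HasDerivAt (fun s : ℝ => 1 - z * s) (-z) s := by
      simpa using ((hasDerivAt_id s).const_mul z).const_sub 1
    convert! ((((hasDerivAt_id s).rpow_const (p := a) (Or.inl hs.1.ne')).mul
      (d1.rpow_const (p := b) (Or.inl hs1.ne'))).mul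
      (d2.rpow_const (p := -β - 1) (Or.inl hpos.ne'))).const_mul (-β) using 1
    have e1 : s ^ (a + 1 - 1) = s ^ (a - 1) * s := by
      rw [← Real.rpow_add_one hs.1.ne']; ring_nf
    have e2 : s ^ (a + 1 + 1 - 1) = s ^ (a - 1) * s * s := by
      rw [← Real.rpow_add_one hs.1.ne', ← Real.rpow_add_one hs.1.ne']; ring_nf
    have e3 : s ^ a = s ^ (a - 1) * s := by
      rw [← Real.rpow_add_one hs.1.ne']; ring_nf
    have e4 : (1 - s) ^ b = (1 - s) ^ (b - 1) * (1 - s) := by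
      rw [← Real.rpow_add_one hs1.ne']; ring_nf
    have e5 : (1 - z * s) ^ (-(β + 1)) = (1 - z * s) ^ (-β - 1 - 1) * (1 - z * s) := by
      rw [← Real.rpow_add_one hpos.ne']; ring_nf
    have e6 : (1 - z * s) ^ (-β) =
        (1 - z * s) ^ (-β - 1 - 1) * (1 - z * s) * (1 - z * s) := by
      rw [← Real.rpow_add_one hpos.ne', ← Real.rpow_add_one hpos.ne']; ring_nf
    have e7 : (1 - z * s) ^ (-β - 1) = (1 - z * s) ^ (-β - 1 - 1) * (1 - z * s) := by
      rw [← Real.rpow_add_one hpos.ne']; ring_nf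
    have e8 : (1 - z * s) ^ (-(β + 1 + 1)) = (1 - z * s) ^ (-β - 1 - 1) := by ring_nf
    simp only [id, Pi.mul_apply, e1, e2, e3, e4, e5, e6, e7, e8]
    ring

/-- for `γ > α > 0`, the Euler-integral hypergeometric function
is twice differentiable on `(0,1)` and satisfies the hypergeometric equation
`z(1−z)F'' + (γ−(α+β+1)z)F' − αβF = 0` there. -/
theorem stmt2 (α β γ : ℝ) (hα : 0 < α) (hγ : α < γ) :
    (∀ z ∈ Set.Ioo (0 : ℝ) 1,
      DifferentiableAt ℝ (hyperF α β γ) z ∧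
        DifferentiableAt ℝ (deriv (hyperF α β γ)) z) ∧
    (∀ z ∈ Set.Ioo (0 : ℝ) 1,
      z * (1 - z) * deriv (deriv (hyperF α β γ)) z
        + (γ - (α + β + 1) * z) * deriv (hyperF α β γ) z
        - α * β * hyperF α β γ z = 0) := by
  have hb : 0 < γ - α := sub_pos.mpr hγ
  set K := Real.Gamma γ / (Real.Gamma α * Real.Gamma (γ - α))
  have hF : hyperF α β γ = fun z => K * eulerIntegral α (γ - α) β z := rfl
  have d1 {z : ℝ} (hz : z < 1) : HasDerivAt (hyperF α β γ)
      (K * (β * eulerIntegral (α + 1) (γ - α) (β + 1) z)) z :=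
    (hasDerivAt_eulerIntegral hα hb β hz).const_mul K
  have d2 {z : ℝ} (hz : z < 1) : HasDerivAt (deriv (hyperF α β γ))
      (K * (β * ((β + 1) * eulerIntegral (α + 1 + 1) (γ - α) (β + 1 + 1) z))) z := by
    refine HasDerivAt.congr_of_eventuallyEq
      (((hasDerivAt_eulerIntegral (by linarith) hb (β + 1) hz).const_mul β).const_mul K) ?_
    filter_upwards [Iio_mem_nhds hz] with x hx using (d1 hx).deriv
  refine ⟨fun z hz => ⟨(d1 hz.2).differentiableAt, (d2 hz.2).differentiableAt⟩, fun z hz => ?_⟩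
  rw [(d1 hz.2).deriv, (d2 hz.2).deriv, hF]
  linear_combination K * eulerIntegral_hypergeometric_equation hα hb β hz.2
end

section
/- Let α, γ be real numbers with γ > α > 0 and set β = γ − α, and let F denote the hypergeometric function defined by the Euler integral representation. Then there exist constants 0 < c ≤ C such that c (1 − ln(1−z)) ≤ F(α,β,γ;z) ≤ C (1 − ln(1−z)) for all z ∈ (0,1). -/
open MeasureTheory

/-- The integrand comparable to the singular part of the Euler integrand near `s = 1`. -/
noncomputable def endpointKernel (b w s : ℝ) : ℝ :=
  (1 - s) ^ (b - 1) / (w ^ b + (1 - s) ^ b)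

lemma endpointKernel_nonneg {b w s : ℝ} (hw : 0 < w) (hs : s ≤ 1) : 0 ≤ endpointKernel b w s := by
  have h : 0 ≤ 1 - s := by linarith
  unfold endpointKernel
  positivity

lemma endpointKernel_integral {b w d : ℝ} (hb : 0 < b) (hw : 0 < w) (hd : d ≤ 1) :
    IntervalIntegrable (endpointKernel b w) volume d 1 ∧
      ∫ s in d..1, endpointKernel b w s = b⁻¹ * Real.log (1 + ((1 - d) / w) ^ b) := by
  have hpos : ∀ s ∈ Set.Icc d 1, 0 < w ^ b + (1 - s) ^ b := fun s hs ↦ by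
    have h : 0 ≤ 1 - s := by linarith [hs.2]
    positivity
  have hcont : ContinuousOn (fun s ↦ -(b⁻¹ * Real.log (w ^ b + (1 - s) ^ b))) (Set.Icc d 1) := by
    refine (continuousOn_const.mul (ContinuousOn.log ?_ fun s hs ↦ (hpos s hs).ne')).neg
    exact (continuous_const.add
      ((continuous_const.sub continuous_id).rpow_const fun _ ↦ Or.inr hb.le)).continuousOn
  have hderiv : ∀ s ∈ Set.Ioo d 1, HasDerivAt
      (fun s ↦ -(b⁻¹ * Real.log (w ^ b + (1 - s) ^ b))) (endpointKernel b w s) s := fun s hs ↦ by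
    have h1 : 0 < 1 - s := by linarith [hs.2]
    have h2 := hpos s ⟨hs.1.le, hs.2.le⟩
    have h := (((((hasDerivAt_id s).const_sub 1).rpow_const (p := b)
      (Or.inl h1.ne')).const_add (w ^ b)).log h2.ne').const_mul b⁻¹ |>.neg
    refine h.congr_deriv ?_
    simp only [id, endpointKernel]
    field_simp
  have hint : IntervalIntegrable (endpointKernel b w) volume d 1 := by
    rw [intervalIntegrable_iff_integrableOn_Ioc_of_le hd]
    exact intervalIntegral.integrableOn_deriv_of_nonneg hcont hderiv
      fun s hs ↦ endpointKernel_nonneg hw hs.2.le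
  refine ⟨hint, ?_⟩
  have h0 : 0 ≤ 1 - d := by linarith
  have hwb : 0 < w ^ b := by positivity
  rw [intervalIntegral.integral_eq_sub_of_hasDerivAt_of_le hd hcont hderiv hint,
    Real.div_rpow h0 hw.le, one_add_div hwb.ne',
    Real.log_div (hpos d ⟨le_rfl, hd⟩).ne' hwb.ne', sub_self, Real.zero_rpow hb.ne', add_zero]
  ring

lemma rpow_add_rpow_le_two_mul {b w t x : ℝ} (hb : 0 ≤ b) (hw : 0 ≤ w) (ht : 0 ≤ t)
    (hwx : w ≤ x) (htx : t ≤ x) : w ^ b + t ^ b ≤ 2 * x ^ b := by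
  linarith [Real.rpow_le_rpow hw hwx hb, Real.rpow_le_rpow ht htx hb]

lemma rpow_le_two_rpow_mul_add {b w t x : ℝ} (hb : 0 ≤ b) (hw : 0 ≤ w) (ht : 0 ≤ t)
    (hx : 0 ≤ x) (hxwt : x ≤ w + t) : x ^ b ≤ 2 ^ b * (w ^ b + t ^ b) := by
  have hwb := Real.rpow_nonneg hw b
  have htb := Real.rpow_nonneg ht b
  have hmax : max w t ^ b ≤ w ^ b + t ^ b := by
    rcases max_choice w t with h | h <;> rw [h] <;> linarith
  calc x ^ b ≤ (2 * max w t) ^ b :=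
        Real.rpow_le_rpow hx (by linarith [le_max_left w t, le_max_right w t]) hb
    _ = 2 ^ b * max w t ^ b := Real.mul_rpow (by norm_num) (le_max_of_le_left hw)
    _ ≤ _ := by gcongr

lemma singular_factor_bounds {b z s : ℝ} (hb : 0 ≤ b) (hz : z ∈ Set.Ioo (0 : ℝ) 1)
    (hs : s ∈ Set.Ioo (0 : ℝ) 1) :
    (2 ^ b)⁻¹ * endpointKernel b (1 - z) s ≤ (1 - s) ^ (b - 1) * (1 - z * s) ^ (-b) ∧
      (1 - s) ^ (b - 1) * (1 - z * s) ^ (-b) ≤ 2 * endpointKernel b (1 - z) s := by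
  obtain ⟨hz0, hz1⟩ := hz
  obtain ⟨hs0, hs1⟩ := hs
  have hw : 0 < 1 - z := by linarith
  have ht : 0 < 1 - s := by linarith
  have hwx : 1 - z ≤ 1 - z * s := by nlinarith
  have htx : 1 - s ≤ 1 - z * s := by nlinarith
  have hx : 0 < 1 - z * s := by linarith
  have h1 := rpow_add_rpow_le_two_mul hb hw.le ht.le hwx htx
  have h2 := rpow_le_two_rpow_mul_add hb hw.le ht.le hx.le
    (show 1 - z * s ≤ (1 - z) + (1 - s) by nlinarith [mul_pos hw ht])
  have hsum : 0 < (1 - z) ^ b + (1 - s) ^ b := by positivity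
  have hxb : 0 < (1 - z * s) ^ b := by positivity
  have htb : 0 ≤ (1 - s) ^ (b - 1) := by positivity
  rw [Real.rpow_neg hx.le, ← div_eq_mul_inv, endpointKernel]
  constructor
  · rw [← div_eq_inv_mul, div_div, mul_comm _ ((2 : ℝ) ^ b)]
    exact div_le_div_of_nonneg_left htb hxb h2
  · rw [← mul_div_assoc, div_le_div_iff₀ hxb hsum]
    nlinarith

lemma endpointKernel_le_inv {b w s : ℝ} (hw : 0 ≤ w) (hs : s < 1) :
    endpointKernel b w s ≤ (1 - s)⁻¹ := by
  have ht : 0 < 1 - s := by linarith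
  have htb : 0 < (1 - s) ^ b := by positivity
  rw [endpointKernel, Real.rpow_sub_one ht.ne', div_div, div_le_iff₀ (by positivity)]
  have : (1 - s)⁻¹ * ((1 - s) * (w ^ b + (1 - s) ^ b)) = w ^ b + (1 - s) ^ b := by
    field_simp
  rw [this]
  linarith [Real.rpow_nonneg hw b]

lemma rpow_bounds_of_half_le {p s : ℝ} (hs : 1 / 2 ≤ s) (hs1 : s ≤ 1) :
    (1 / 2 : ℝ) ^ |p| ≤ s ^ p ∧ s ^ p ≤ (1 / 2 : ℝ) ^ (-|p|) := by
  have hs0 : 0 < s := by linarith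
  constructor
  · exact (Real.rpow_le_rpow (by norm_num) hs (abs_nonneg p)).trans
      (Real.rpow_le_rpow_of_exponent_ge hs0 hs1 (le_abs_self p))
  · exact (Real.rpow_le_rpow_of_exponent_ge hs0 hs1 (neg_abs_le p)).trans
      (Real.rpow_le_rpow_of_nonpos (by norm_num) hs (by simp))

lemma rpow_mul_endpointKernel_le {p b w s : ℝ} (hw : 0 < w) (hs : s ∈ Set.Ioo (0 : ℝ) 1) :
    s ^ p * endpointKernel b w s ≤
      2 * s ^ p + (1 / 2 : ℝ) ^ (-|p|) * endpointKernel b w s := by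
  have hk : 0 ≤ endpointKernel b w s := endpointKernel_nonneg hw hs.2.le
  have hsp : 0 ≤ s ^ p := Real.rpow_nonneg hs.1.le p
  have hM : (0 : ℝ) ≤ (1 / 2 : ℝ) ^ (-|p|) := by positivity
  rcases le_total s (1 / 2) with h | h
  · have hk2 : endpointKernel b w s ≤ 2 :=
      (endpointKernel_le_inv hw.le hs.2).trans
        (inv_le_of_inv_le₀ (by norm_num) (by norm_num; linarith))
    nlinarith [mul_nonneg hM hk]
  · nlinarith [mul_le_mul_of_nonneg_right (rpow_bounds_of_half_le (p := p) h hs.2.le).2 hk]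

lemma log_one_add_inv_rpow_le {b w : ℝ} (hb : 0 < b) (hw : 0 < w) (hw1 : w ≤ 1) :
    Real.log (1 + (1 / w) ^ b) ≤ (1 + b) * (1 - Real.log w) := by
  have hlog : Real.log w ≤ 0 := Real.log_nonpos hw.le hw1
  have h1 : 1 ≤ (1 / w) ^ b := Real.one_le_rpow ((one_le_div hw).2 hw1) hb.le
  have h2 : Real.log (1 + (1 / w) ^ b) ≤ Real.log (2 * (1 / w) ^ b) :=
    Real.log_le_log (by positivity) (by linarith)
  rw [Real.log_mul (by norm_num) (by positivity), Real.log_rpow (by positivity), one_div,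
    Real.log_inv] at h2
  rw [one_div]
  nlinarith [Real.log_two_lt_d9]

lemma le_log_one_add_half_div_rpow {b w : ℝ} (hb : 0 < b) (hw : 0 < w) (hw1 : w ≤ 1) :
    b * (1 - Real.log w) ≤ (b * (1 + Real.log 2) / Real.log (1 + (1 / 2) ^ b) + 1) *
      Real.log (1 + (1 / 2 / w) ^ b) := by
  have hk : 0 < Real.log (1 + (1 / 2 : ℝ) ^ b) :=
    Real.log_pos (by linarith [Real.rpow_pos_of_pos (show (0 : ℝ) < 1 / 2 by norm_num) b])
  have h1 : Real.log (1 + (1 / 2 : ℝ) ^ b) ≤ Real.log (1 + (1 / 2 / w) ^ b) := by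
    refine Real.log_le_log (by positivity) ?_
    have hle : (1 / 2 : ℝ) ≤ 1 / 2 / w := le_div_self (by norm_num) hw hw1
    linarith [Real.rpow_le_rpow (by norm_num) hle hb.le]
  have h2 : Real.log ((1 / 2 / w) ^ b) ≤ Real.log (1 + (1 / 2 / w) ^ b) :=
    Real.log_le_log (by positivity) (by linarith)
  rw [Real.log_rpow (by positivity), Real.log_div (by norm_num) hw.ne', one_div, Real.log_inv] at h2
  have h3 : b * (1 + Real.log 2) ≤
      b * (1 + Real.log 2) / Real.log (1 + (1 / 2 : ℝ) ^ b) * Real.log (1 + (1 / 2 / w) ^ b) := by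
    rw [div_mul_eq_mul_div, le_div_iff₀ hk]
    have := Real.log_pos (show (1 : ℝ) < 2 by norm_num)
    gcongr
  simp only [one_div] at *
  linarith

lemma euler_integrand_le {a b z s : ℝ} (hb : 0 ≤ b) (hz : z ∈ Set.Ioo (0 : ℝ) 1)
    (hs : s ∈ Set.Ioo (0 : ℝ) 1) :
    s ^ (a - 1) * (1 - s) ^ (b - 1) * (1 - z * s) ^ (-b) ≤
      2 * (2 * s ^ (a - 1) + (1 / 2 : ℝ) ^ (-|a - 1|) * endpointKernel b (1 - z) s) := by
  have h1 := mul_le_mul_of_nonneg_left (singular_factor_bounds hb hz hs).2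
    (Real.rpow_nonneg hs.1.le (a - 1))
  have h2 := rpow_mul_endpointKernel_le (p := a - 1) (b := b) (sub_pos.2 hz.2) hs
  linarith

lemma euler_integrand_ge {a b z s : ℝ} (hb : 0 ≤ b) (hz : z ∈ Set.Ioo (0 : ℝ) 1)
    (hs : s ∈ Set.Ioo (1 / 2 : ℝ) 1) :
    (1 / 2 : ℝ) ^ |a - 1| * (2 ^ b)⁻¹ * endpointKernel b (1 - z) s ≤
      s ^ (a - 1) * (1 - s) ^ (b - 1) * (1 - z * s) ^ (-b) := by
  have hs0 : 0 < s := by linarith [hs.1]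
  have hk := endpointKernel_nonneg (b := b) (sub_pos.2 hz.2) hs.2.le
  rw [mul_assoc, mul_assoc]
  exact mul_le_mul (rpow_bounds_of_half_le hs.1.le hs.2.le).1
    (singular_factor_bounds hb hz ⟨hs0, hs.2⟩).1 (by positivity) (by positivity)

lemma euler_integrand_nonneg {a b z s : ℝ} (hz : z ∈ Set.Ioo (0 : ℝ) 1)
    (hs : s ∈ Set.Ioc (0 : ℝ) 1) :
    0 ≤ s ^ (a - 1) * (1 - s) ^ (b - 1) * (1 - z * s) ^ (-b) := by
  have h0 := hs.1
  have h1 : 0 ≤ 1 - s := by linarith [hs.2]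
  have h2 : 0 ≤ 1 - z * s := by nlinarith [hz.1, hz.2, hs.2]
  positivity

lemma euler_majorant_intervalIntegrable {a b z : ℝ} (ha : 0 < a) (hb : 0 < b) (hz : z < 1) :
    IntervalIntegrable (fun s ↦ 2 * (2 * s ^ (a - 1) +
      (1 / 2 : ℝ) ^ (-|a - 1|) * endpointKernel b (1 - z) s)) volume 0 1 :=
  (((intervalIntegral.intervalIntegrable_rpow' (by linarith)).const_mul 2).add
    ((endpointKernel_integral hb (sub_pos.2 hz) zero_le_one).1.const_mul _)).const_mul 2

lemma euler_integrand_intervalIntegrable {a b z : ℝ} (ha : 0 < a) (hb : 0 < b)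
    (hz : z ∈ Set.Ioo (0 : ℝ) 1) :
    IntervalIntegrable (fun s ↦ s ^ (a - 1) * (1 - s) ^ (b - 1) * (1 - z * s) ^ (-b))
      volume 0 1 := by
  have hmaj := euler_majorant_intervalIntegrable ha hb hz.2
  rw [intervalIntegrable_iff_integrableOn_Ioo_of_le zero_le_one] at hmaj ⊢
  refine hmaj.mono' (by fun_prop) ?_
  filter_upwards [ae_restrict_mem measurableSet_Ioo] with s hs
  rw [Real.norm_of_nonneg (euler_integrand_nonneg hz ⟨hs.1, hs.2.le⟩)]
  exact euler_integrand_le hb.le hz hs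

lemma euler_integral_le {a b z : ℝ} (ha : 0 < a) (hb : 0 < b) (hz : z ∈ Set.Ioo (0 : ℝ) 1) :
    ∫ s in (0 : ℝ)..1, s ^ (a - 1) * (1 - s) ^ (b - 1) * (1 - z * s) ^ (-b) ≤
      2 * (2 / a + (1 / 2 : ℝ) ^ (-|a - 1|) * (b⁻¹ * (1 + b))) * (1 - Real.log (1 - z)) := by
  have hw : 0 < 1 - z := sub_pos.2 hz.2
  have hL : Real.log (1 - z) ≤ 0 := Real.log_nonpos hw.le (by linarith [hz.1])
  obtain ⟨hki, hke⟩ := endpointKernel_integral hb hw zero_le_one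
  have hri : IntervalIntegrable (fun s : ℝ ↦ s ^ (a - 1)) volume 0 1 :=
    intervalIntegral.intervalIntegrable_rpow' (by linarith)
  have h := intervalIntegral.integral_mono_on_of_le_Ioo zero_le_one
    (euler_integrand_intervalIntegrable ha hb hz) (euler_majorant_intervalIntegrable ha hb hz.2)
    fun s hs ↦ euler_integrand_le hb.le hz hs
  refine h.trans ?_
  rw [intervalIntegral.integral_const_mul,
    intervalIntegral.integral_add (hri.const_mul 2) (hki.const_mul _),
    intervalIntegral.integral_const_mul, intervalIntegral.integral_const_mul, hke,
    integral_rpow (Or.inl (by linarith)), sub_add_cancel, Real.one_rpow, Real.zero_rpow ha.ne',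
    sub_zero, mul_one_div, mul_assoc, add_mul]
  have hlog := log_one_add_inv_rpow_le hb hw (by linarith [hz.1])
  have h1 : 2 / a ≤ 2 / a * (1 - Real.log (1 - z)) :=
    le_mul_of_one_le_right (by positivity) (by linarith)
  rw [mul_assoc _ (b⁻¹ * (1 + b)), mul_assoc b⁻¹]
  gcongr

lemma exists_le_euler_integral {a b : ℝ} (ha : 0 < a) (hb : 0 < b) :
    ∃ c : ℝ, 0 < c ∧ ∀ z ∈ Set.Ioo (0 : ℝ) 1, c * (1 - Real.log (1 - z)) ≤
      ∫ s in (0 : ℝ)..1, s ^ (a - 1) * (1 - s) ^ (b - 1) * (1 - z * s) ^ (-b) := by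
  set K := b * (1 + Real.log 2) / Real.log (1 + (1 / 2) ^ b) + 1 with hK
  have hK0 : 0 < K := by
    have h2 := Real.log_pos (show (1 : ℝ) < 2 by norm_num)
    have hk : 0 < Real.log (1 + (1 / 2 : ℝ) ^ b) :=
      Real.log_pos (by linarith [Real.rpow_pos_of_pos (show (0 : ℝ) < 1 / 2 by norm_num) b])
    positivity
  refine ⟨(1 / 2 : ℝ) ^ |a - 1| * (2 ^ b)⁻¹ * K⁻¹, by positivity, fun z hz ↦ ?_⟩
  have hw : 0 < 1 - z := sub_pos.2 hz.2
  obtain ⟨hki, hke⟩ := endpointKernel_integral hb hw (show (1 / 2 : ℝ) ≤ 1 by norm_num)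
  have hei := euler_integrand_intervalIntegrable ha hb hz
  have hlog := le_log_one_add_half_div_rpow hb hw (by linarith [hz.1])
  rw [← hK] at hlog
  calc (1 / 2 : ℝ) ^ |a - 1| * (2 ^ b)⁻¹ * K⁻¹ * (1 - Real.log (1 - z))
      ≤ (1 / 2 : ℝ) ^ |a - 1| * (2 ^ b)⁻¹ *
          (b⁻¹ * Real.log (1 + ((1 - 1 / 2) / (1 - z)) ^ b)) := by
        rw [mul_assoc _ K⁻¹]
        refine mul_le_mul_of_nonneg_left ?_ (by positivity)
        rw [← div_eq_inv_mul, ← div_eq_inv_mul, div_le_div_iff₀ hK0 hb, sub_half]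
        linarith
    _ = ∫ s in (1 / 2 : ℝ)..1,
          (1 / 2 : ℝ) ^ |a - 1| * (2 ^ b)⁻¹ * endpointKernel b (1 - z) s := by
        rw [intervalIntegral.integral_const_mul, hke]
    _ ≤ ∫ s in (1 / 2 : ℝ)..1, s ^ (a - 1) * (1 - s) ^ (b - 1) * (1 - z * s) ^ (-b) :=
        intervalIntegral.integral_mono_on_of_le_Ioo (by norm_num) (hki.const_mul _)
          (hei.mono_set (by
            rw [Set.uIcc_of_le (by norm_num), Set.uIcc_of_le (by norm_num)]
            exact Set.Icc_subset_Icc_left (by norm_num)))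
          fun s hs ↦ euler_integrand_ge hb.le hz hs
    _ ≤ _ := by
        refine intervalIntegral.integral_mono_interval (by norm_num) (by norm_num) le_rfl ?_ hei
        filter_upwards [ae_restrict_mem measurableSet_Ioc] with s hs
        exact euler_integrand_nonneg hz hs

/-- for `γ > α > 0` and `β = γ − α`, one has
`c (1 − ln(1−z)) ≤ F(α,β,γ;z) ≤ C (1 − ln(1−z))` on `(0,1)` for some
constants `0 < c ≤ C`. -/
theorem stmt7 (α γ : ℝ) (hα : 0 < α) (hγ : α < γ) :
    ∃ c C : ℝ, 0 < c ∧ c ≤ C ∧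
      ∀ z ∈ Set.Ioo (0 : ℝ) 1,
        c * (1 - Real.log (1 - z)) ≤ hyperF α (γ - α) γ z ∧
          hyperF α (γ - α) γ z ≤ C * (1 - Real.log (1 - z)) := by
  have hb : 0 < γ - α := sub_pos.2 hγ
  obtain ⟨c, hc, hlow⟩ := exists_le_euler_integral hα hb
  have hup := fun z hz ↦ euler_integral_le (z := z) hα hb hz
  set C := 2 * (2 / α + (1 / 2 : ℝ) ^ (-|α - 1|) * ((γ - α)⁻¹ * (1 + (γ - α))))
  have hG : 0 < Real.Gamma γ / (Real.Gamma α * Real.Gamma (γ - α)) :=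
    div_pos (Real.Gamma_pos_of_pos (hα.trans hγ))
      (mul_pos (Real.Gamma_pos_of_pos hα) (Real.Gamma_pos_of_pos hb))
  set G := Real.Gamma γ / (Real.Gamma α * Real.Gamma (γ - α)) with hGdef
  refine ⟨G * c, G * max c C, mul_pos hG hc,
    mul_le_mul_of_nonneg_left (le_max_left c C) hG.le, fun z hz ↦ ?_⟩
  have hL : 0 ≤ 1 - Real.log (1 - z) := by
    linarith [Real.log_nonpos (sub_pos.2 hz.2).le (by linarith [hz.1])]
  rw [hyperF, ← hGdef, mul_assoc, mul_assoc]
  exact ⟨mul_le_mul_of_nonneg_left (hlow z hz) hG.le,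
    mul_le_mul_of_nonneg_left ((hup z hz).trans
      (mul_le_mul_of_nonneg_right (le_max_right c C) hL)) hG.le⟩
end

section
/- Let α, β, γ be real numbers with γ > α > 0 and β > γ − α, and let F denote the hypergeometric function defined by the Euler integral representation. Then there exist constants 0 < c ≤ C such that c (1−z)^{γ−α−β} ≤ F(α,β,γ;z) ≤ C (1−z)^{γ−α−β} for all z ∈ (0,1). -/
open MeasureTheory

theorem integrableOn_beta {a b : ℝ} (ha : 0 < a) (hb : 0 < b) :
    IntegrableOn (fun t : ℝ => t ^ (a - 1) * (1 - t) ^ (b - 1)) (Set.Ioo 0 1) := by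
  have h := Complex.betaIntegral_convergent (u := (a : ℂ)) (v := (b : ℂ))
    (by simpa using ha) (by simpa using hb)
  rw [intervalIntegrable_iff_integrableOn_Ioo_of_le zero_le_one] at h
  refine IntegrableOn.congr_fun h.re (fun t ht => ?_) measurableSet_Ioo
  have h1 : ((t : ℂ) ^ ((a : ℂ) - 1)) = ((t ^ (a - 1) : ℝ) : ℂ) := by
    rw [Complex.ofReal_cpow ht.1.le]; simp
  have h2 : ((1 - (t : ℂ)) ^ ((b : ℂ) - 1)) = (((1 - t) ^ (b - 1) : ℝ) : ℂ) := by
    rw [Complex.ofReal_cpow (by linarith [ht.2])]; simp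
  simp only [h1, h2, ← Complex.ofReal_mul]
  simp

theorem setIntegral_beta_pos {a b : ℝ} (ha : 0 < a) (hb : 0 < b) :
    0 < ∫ t in Set.Ioo (0 : ℝ) 1, t ^ (a - 1) * (1 - t) ^ (b - 1) := by
  rw [← integral_Ioc_eq_integral_Ioo, ← intervalIntegral.integral_of_le zero_le_one]
  refine intervalIntegral.intervalIntegral_pos_of_pos_on
    ((intervalIntegrable_iff_integrableOn_Ioo_of_le zero_le_one).2 (integrableOn_beta ha hb))
    (fun t ht => ?_) zero_lt_one
  have := ht.1
  have : 0 < 1 - t := by linarith [ht.2]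
  positivity

theorem one_sub_div_one_sub_mul {z t : ℝ} (h : 1 - z * t ≠ 0) :
    1 - (1 - t) / (1 - z * t) = t * (1 - z) / (1 - z * t) := by
  rw [eq_div_iff h, sub_mul, div_mul_cancel₀ _ h]
  ring

theorem one_sub_mul_div_one_sub_mul {z t : ℝ} (h : 1 - z * t ≠ 0) :
    1 - z * ((1 - t) / (1 - z * t)) = (1 - z) / (1 - z * t) := by
  rw [eq_div_iff h, sub_mul, mul_assoc, div_mul_cancel₀ _ h]
  ring

/-- The involution `t ↦ (1 - t) / (1 - z t)` maps the open unit interval onto itself. -/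
theorem image_one_sub_div_one_sub_mul {z : ℝ} (hz : z < 1) :
    (fun t : ℝ => (1 - t) / (1 - z * t)) '' Set.Ioo 0 1 = Set.Ioo 0 1 := by
  have key : ∀ t ∈ Set.Ioo (0 : ℝ) 1, (1 - t) / (1 - z * t) ∈ Set.Ioo (0 : ℝ) 1 ∧
      (1 - (1 - t) / (1 - z * t)) / (1 - z * ((1 - t) / (1 - z * t))) = t := by
    intro t ht
    have h0 := ht.1
    have h1 := ht.2
    have hp : 0 < 1 - z * t := by nlinarith
    have hp' := hp.ne'
    have hz' : 1 - z ≠ 0 := by linarith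
    refine ⟨⟨div_pos (by linarith) hp, (div_lt_one hp).2 (by nlinarith)⟩, ?_⟩
    rw [one_sub_div_one_sub_mul hp', one_sub_mul_div_one_sub_mul hp',
      div_div_div_cancel_right₀ hp', mul_div_cancel_right₀ _ hz']
  ext s
  constructor
  · rintro ⟨t, ht, rfl⟩
    exact (key t ht).1
  · intro hs
    exact ⟨_, (key s hs).1, (key s hs).2⟩

theorem injOn_one_sub_div_one_sub_mul {z : ℝ} (hz : z < 1) :
    Set.InjOn (fun t : ℝ => (1 - t) / (1 - z * t)) (Set.Ioo 0 1) := by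
  intro t ht u hu h
  have hp : 0 < 1 - z * t := by nlinarith [ht.1, ht.2]
  have hq : 0 < 1 - z * u := by nlinarith [hu.1, hu.2]
  have hz' : 1 - z ≠ 0 := by linarith
  simp only at h
  rw [div_eq_div_iff hp.ne' hq.ne'] at h
  exact mul_left_cancel₀ hz' (by linarith)

/-- Euler's transformation, at the level of the Euler integral. -/
theorem euler_integral_transformation (α β γ : ℝ) {z : ℝ} (hz : z < 1) :
    ∫ s in (0 : ℝ)..1, s ^ (α - 1) * (1 - s) ^ (γ - α - 1) * (1 - z * s) ^ (-β) =
      (1 - z) ^ (γ - α - β) * ∫ t in Set.Ioo (0 : ℝ) 1,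
        t ^ (γ - α - 1) * (1 - t) ^ (α - 1) * (1 - z * t) ^ (β - γ) := by
  rw [intervalIntegral.integral_of_le zero_le_one, integral_Ioc_eq_integral_Ioo, ← integral_const_mul]
  conv_lhs => rw [← image_one_sub_div_one_sub_mul hz]
  rw [integral_image_eq_integral_abs_deriv_smul (f' := fun t => -(1 - z) / (1 - z * t) ^ 2)
    measurableSet_Ioo _ (injOn_one_sub_div_one_sub_mul hz)]
  · refine setIntegral_congr_fun measurableSet_Ioo (fun t ht => ?_)
    have h0 := ht.1
    have h1 : 0 < 1 - t := by linarith [ht.2]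
    have hp : 0 < 1 - z * t := by nlinarith
    have hp' := hp.ne'
    have hz' : 0 < 1 - z := by linarith
    have habs : |-(1 - z) / (1 - z * t) ^ 2| = (1 - z) / (1 - z * t) ^ 2 := by
      rw [abs_div, abs_neg, abs_of_pos hz', abs_of_pos (by positivity)]
    have hsplit : (1 - z) ^ (γ - α - β) = (1 - z) ^ (γ - α - 1) * (1 - z) ^ (-β) * (1 - z) := by
      rw [← Real.rpow_add hz', ← Real.rpow_add_one hz'.ne']
      ring_nf
    have hcancel : (1 - z * t) ^ (β - γ) * ((1 - z * t) ^ (α - 1) * (1 - z * t) ^ (γ - α - 1) *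
        (1 - z * t) ^ (-β) * (1 - z * t) ^ 2) = 1 := by
      rw [← Real.rpow_natCast, ← Real.rpow_add hp, ← Real.rpow_add hp, ← Real.rpow_add hp,
        ← Real.rpow_add hp]
      convert Real.rpow_zero (1 - z * t) using 2
      push_cast
      ring
    simp only [smul_eq_mul]
    rw [one_sub_div_one_sub_mul hp', one_sub_mul_div_one_sub_mul hp', habs, hsplit,
      Real.div_rpow h1.le hp.le, Real.div_rpow (by positivity) hp.le,
      Real.div_rpow hz'.le hp.le, Real.mul_rpow h0.le hz'.le,
      eq_div_of_mul_eq (by positivity) hcancel]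
    field_simp
  · intro t ht
    have hp : 0 < 1 - z * t := by nlinarith [ht.1, ht.2]
    have hn : HasDerivAt (fun t : ℝ => 1 - t) (-1) t := (hasDerivAt_id t).const_sub 1
    have hd : HasDerivAt (fun t : ℝ => 1 - z * t) (-z) t := by
      simpa using ((hasDerivAt_id t).const_mul z).const_sub 1
    exact ((hn.div hd hp.ne').congr_deriv (by ring)).hasDerivWithinAt

theorem rpow_bounds_one_sub_mul (δ : ℝ) {z t : ℝ} (hz : z ∈ Set.Ioo (0 : ℝ) 1)
    (ht : t ∈ Set.Ioo (0 : ℝ) 1) :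
    (1 - t) ^ max δ 0 ≤ (1 - z * t) ^ δ ∧ (1 - z * t) ^ δ ≤ (1 - t) ^ min δ 0 := by
  obtain ⟨hz0, hz1⟩ := hz
  obtain ⟨ht0, ht1⟩ := ht
  have h1 : 0 < 1 - t := by linarith
  have hle : 1 - t ≤ 1 - z * t := by nlinarith
  have hp : 0 < 1 - z * t := by linarith
  have hp1 : 1 - z * t ≤ 1 := by nlinarith
  rcases le_total 0 δ with h | h
  · rw [max_eq_left h, min_eq_right h, Real.rpow_zero]
    exact ⟨Real.rpow_le_rpow h1.le hle h, Real.rpow_le_one hp.le hp1 h⟩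
  · rw [max_eq_right h, min_eq_left h, Real.rpow_zero]
    exact ⟨Real.one_le_rpow_of_pos_of_le_one_of_nonpos hp hp1 h,
      Real.rpow_le_rpow_of_nonpos h1 hle h⟩

theorem setIntegral_beta_mul_rpow_bounds {a b δ z : ℝ} (ha : 0 < a) (hb : 0 < b)
    (hδ : 0 < b + δ) (hz : z ∈ Set.Ioo (0 : ℝ) 1) :
    ∫ t in Set.Ioo (0 : ℝ) 1, t ^ (a - 1) * (1 - t) ^ (b + max δ 0 - 1) ≤
        ∫ t in Set.Ioo (0 : ℝ) 1, t ^ (a - 1) * (1 - t) ^ (b - 1) * (1 - z * t) ^ δ ∧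
      ∫ t in Set.Ioo (0 : ℝ) 1, t ^ (a - 1) * (1 - t) ^ (b - 1) * (1 - z * t) ^ δ ≤
        ∫ t in Set.Ioo (0 : ℝ) 1, t ^ (a - 1) * (1 - t) ^ (b + min δ 0 - 1) := by
  have hmin : 0 < b + min δ 0 := by
    rcases min_choice δ 0 with h | h <;> rw [h] <;> linarith
  have hmax : 0 < b + max δ 0 := by linarith [le_max_right δ 0]
  have hsplit : ∀ e : ℝ, ∀ t ∈ Set.Ioo (0 : ℝ) 1,
      t ^ (a - 1) * (1 - t) ^ (b + e - 1) = t ^ (a - 1) * (1 - t) ^ (b - 1) * (1 - t) ^ e := by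
    intro e t ht
    rw [mul_assoc, ← Real.rpow_add (by linarith [ht.2])]
    ring_nf
  have hnonneg : ∀ t ∈ Set.Ioo (0 : ℝ) 1, 0 ≤ t ^ (a - 1) * (1 - t) ^ (b - 1) := fun t ht =>
    mul_nonneg (Real.rpow_nonneg ht.1.le _) (Real.rpow_nonneg (by linarith [ht.2]) _)
  have hlow : ∀ t ∈ Set.Ioo (0 : ℝ) 1, t ^ (a - 1) * (1 - t) ^ (b + max δ 0 - 1) ≤
      t ^ (a - 1) * (1 - t) ^ (b - 1) * (1 - z * t) ^ δ := fun t ht => by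
    rw [hsplit _ t ht]
    exact mul_le_mul_of_nonneg_left (rpow_bounds_one_sub_mul δ hz ht).1 (hnonneg t ht)
  have hupp : ∀ t ∈ Set.Ioo (0 : ℝ) 1, t ^ (a - 1) * (1 - t) ^ (b - 1) * (1 - z * t) ^ δ ≤
      t ^ (a - 1) * (1 - t) ^ (b + min δ 0 - 1) := fun t ht => by
    rw [hsplit _ t ht]
    exact mul_le_mul_of_nonneg_left (rpow_bounds_one_sub_mul δ hz ht).2 (hnonneg t ht)
  have hint : IntegrableOn (fun t : ℝ => t ^ (a - 1) * (1 - t) ^ (b - 1) * (1 - z * t) ^ δ)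
      (Set.Ioo 0 1) := by
    refine Integrable.mono' (integrableOn_beta ha hmin)
      (by fun_prop : Measurable _).aestronglyMeasurable ?_
    filter_upwards [ae_restrict_mem measurableSet_Ioo] with t ht
    rw [Real.norm_of_nonneg (mul_nonneg (hnonneg t ht)
      (Real.rpow_nonneg (by nlinarith [ht.1, ht.2, hz.2]) _))]
    exact hupp t ht
  exact ⟨setIntegral_mono_on (integrableOn_beta ha hmax) hint measurableSet_Ioo hlow,
    setIntegral_mono_on hint (integrableOn_beta ha hmin) measurableSet_Ioo hupp⟩

/-- for `γ > α > 0` and `β > γ − α`, one has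
`c (1−z)^(γ−α−β) ≤ F(α,β,γ;z) ≤ C (1−z)^(γ−α−β)` on `(0,1)` for some
constants `0 < c ≤ C`. -/
theorem stmt8 (α β γ : ℝ) (hα : 0 < α) (hγ : α < γ) (hβ : γ - α < β) :
    ∃ c C : ℝ, 0 < c ∧ c ≤ C ∧
      ∀ z ∈ Set.Ioo (0 : ℝ) 1,
        c * (1 - z) ^ (γ - α - β) ≤ hyperF α β γ z ∧
          hyperF α β γ z ≤ C * (1 - z) ^ (γ - α - β) := by
  have hγα : 0 < γ - α := sub_pos.2 hγ
  have hδ : 0 < α + (β - γ) := by linarith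
  have hK : 0 < Real.Gamma γ / (Real.Gamma α * Real.Gamma (γ - α)) :=
    div_pos (Real.Gamma_pos_of_pos (hα.trans hγ))
      (mul_pos (Real.Gamma_pos_of_pos hα) (Real.Gamma_pos_of_pos hγα))
  have hbounds := fun z (hz : z ∈ Set.Ioo (0 : ℝ) 1) =>
    setIntegral_beta_mul_rpow_bounds hγα hα hδ hz
  have hhalf := hbounds (1 / 2) (by norm_num)
  refine ⟨_, _, mul_pos hK (setIntegral_beta_pos hγα
    (by linarith [le_max_right (β - γ) 0] : 0 < α + max (β - γ) 0)),
    mul_le_mul_of_nonneg_left (hhalf.1.trans hhalf.2) hK.le, fun z hz => ?_⟩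
  have hpow : 0 ≤ (1 - z) ^ (γ - α - β) := Real.rpow_nonneg (by linarith [hz.2]) _
  rw [hyperF, euler_integral_transformation α β γ hz.2,
    mul_comm ((1 - z) ^ (γ - α - β)), ← mul_assoc]
  exact ⟨mul_le_mul_of_nonneg_right (mul_le_mul_of_nonneg_left (hbounds z hz).1 hK.le) hpow,
    mul_le_mul_of_nonneg_right (mul_le_mul_of_nonneg_left (hbounds z hz).2 hK.le) hpow⟩
end
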